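/- Let n ≥ 1 be an integer and let f be a bounded continuous function on [0,∞) with f ∈ W²_0(ψ) and with D̃f bounded and continuous on (0,∞) (extended by its limit 0 at x = 0). Then Ṽ_n f = V_n(f − (1/n)·D̃f) on [0,∞). -/

import Mathlib

open MeasureTheory Filter Set

/-- Baskakov basis functions `P_{n,k}(x)`, with `P_{n,k} := 0` for `k < 0`. -/
noncomputable def P (n : ℕ) (k : ℤ) (x : ℝ) : ℝ :=
  if k < 0 then 0
  else (Nat.choose (n + k.toNat - 1) k.toNat : ℝ) * x ^ k.toNat * (1 + x) ^ (-(n : ℤ) - k)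

/-- The weight `ψ(x) = x(1+x)`. -/
noncomputable def psi (x : ℝ) : ℝ := x * (1 + x)

/-- The differential operator `D̃ f = ψ f''`. -/
noncomputable def Dt (f : ℝ → ℝ) : ℝ → ℝ := fun x => psi x * deriv (deriv f) x

/-- The functionals `v_{n,k}`. -/
noncomputable def v (n k : ℕ) (f : ℝ → ℝ) : ℝ :=
  if k = 0 then f 0
  else ((n : ℝ) + 1) * ∫ t in Set.Ioi (0 : ℝ), P (n + 2) ((k : ℤ) - 1) t * f t

/-- The Goodman–Sharma–Baskakov operator `V_n`. -/
noncomputable def V (n : ℕ) (f : ℝ → ℝ) (x : ℝ) : ℝ :=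
  ∑' k : ℕ, v n k f * P n (k : ℤ) x

/-- The modified operator `Ṽ_n`. -/
noncomputable def Vt (n : ℕ) (f : ℝ → ℝ) (x : ℝ) : ℝ :=
  ∑' k : ℕ, v n k f * (P n (k : ℤ) x - (1 / (n : ℝ)) * Dt (P n (k : ℤ)) x)

/-- Supremum norm on `[0,∞)`. -/
noncomputable def supNorm (f : ℝ → ℝ) : ℝ := ⨆ x ∈ Set.Ici (0 : ℝ), |f x|

/-- `f` is bounded and continuous on `[0,∞)`. -/
def BddContOn (f : ℝ → ℝ) : Prop :=
  ContinuousOn f (Set.Ici 0) ∧ ∃ M, ∀ x ∈ Set.Ici (0 : ℝ), |f x| ≤ M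

/-- The space `W²(ψ)`: `g, g'` (locally) differentiable on `(0,∞)` and `D̃ g` bounded. -/
def MemW2 (g : ℝ → ℝ) : Prop :=
  DifferentiableOn ℝ g (Set.Ioi 0) ∧ DifferentiableOn ℝ (deriv g) (Set.Ioi 0) ∧
    ∃ M, ∀ x ∈ Set.Ioi (0 : ℝ), |Dt g x| ≤ M

/-- The space `W²₀(ψ)`: members of `W²(ψ)` with `D̃ g(x) → 0` as `x → 0⁺`. -/
def MemW20 (g : ℝ → ℝ) : Prop :=
  MemW2 g ∧ Filter.Tendsto (Dt g) (nhdsWithin 0 (Set.Ioi 0)) (nhds 0)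

/-- The K-functional `K(f,t)`. -/
noncomputable def Kfun (f : ℝ → ℝ) (t : ℝ) : ℝ :=
  sInf {a : ℝ | ∃ g : ℝ → ℝ, MemW20 g ∧ MemW2 (Dt g) ∧
    a = supNorm (fun x => f x - g x) + t * supNorm (Dt (Dt g))}

/-- The function `T_{n,k}(x)`. -/
noncomputable def T (n : ℕ) (k : ℤ) (x : ℝ) : ℝ :=
  (k : ℝ) * ((k : ℝ) - 1) * (1 + x) / x - 2 * (k : ℝ) * ((n : ℝ) + (k : ℝ))
    + ((n : ℝ) + (k : ℝ)) * ((n : ℝ) + (k : ℝ) + 1) * x / (1 + x)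
open scoped Topology

section Basis

theorem P_of_neg (n : ℕ) {k : ℤ} (hk : k < 0) (x : ℝ) : P n k x = 0 := by
  simp [P, hk]

theorem P_succ_natCast (m j : ℕ) (x : ℝ) :
    P (m + 1) (j : ℤ) x = ((m + j).choose j : ℝ) * x ^ j * ((1 + x) ^ (m + 1 + j))⁻¹ := by
  have h : (-((m + 1 : ℕ) : ℤ) - j) = -((m + 1 + j : ℕ) : ℤ) := by push_cast; ring
  have h' : m + 1 + j - 1 = m + j := by omega
  rw [P, if_neg (by omega), h, zpow_neg, zpow_natCast, Int.toNat_natCast, h']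

theorem P_nonneg (n : ℕ) (k : ℤ) {x : ℝ} (hx : 0 ≤ x) : 0 ≤ P n k x := by
  unfold P
  split_ifs <;> positivity

theorem P_succ_zero_zero (m : ℕ) : P (m + 1) 0 0 = 1 := by
  simpa using P_succ_natCast m 0 0

theorem P_apply_zero (n : ℕ) {k : ℤ} (hk : k ≠ 0) : P n k 0 = 0 := by
  unfold P
  split_ifs with h
  · rfl
  · have : k.toNat ≠ 0 := by omega
    simp [this]

/-- Relation between the binomial coefficients of `P (m + 1) (j + 1)` and `P (m + 2) j`. -/
theorem choose_mul_eq_choose_mul (m j : ℕ) :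
    ((m + (j + 1)).choose (j + 1) : ℝ) * (j + 1) = (m + 1) * ((m + 1 + j).choose j : ℝ) := by
  have h := Nat.choose_succ_right_eq (m + 1 + j) j
  rw [show m + 1 + j - j = m + 1 by omega, show m + 1 + j = m + (j + 1) by omega] at h
  rw [show m + 1 + j = m + (j + 1) by omega]
  have : ((m + (j + 1)).choose (j + 1) : ℝ) * (j + 1) = ((m + (j + 1)).choose j : ℝ) * (m + 1) := by
    exact_mod_cast h
  linarith

/-- Relation between the binomial coefficients of `P (m + 1) j` and `P (m + 2) j`. -/
theorem choose_mul_eq_choose_succ_mul (m j : ℕ) :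
    ((m + j).choose j : ℝ) * (m + j + 1) = (m + 1) * ((m + 1 + j).choose j : ℝ) := by
  have h := Nat.choose_mul_succ_eq (m + j) j
  rw [show m + j + 1 - j = m + 1 by omega, show m + j + 1 = m + 1 + j by omega] at h
  have : ((m + j).choose j : ℝ) * (m + 1 + j) = ((m + 1 + j).choose j : ℝ) * (m + 1) := by
    exact_mod_cast h
  linarith

theorem hasDerivAt_P_succ (m : ℕ) (k : ℤ) {x : ℝ} (hx : -1 < x) :
    HasDerivAt (P (m + 1) k) ((m + 1) * (P (m + 2) (k - 1) x - P (m + 2) k x)) x := by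
  have hx0 : 1 + x ≠ 0 := by linarith
  rcases lt_or_ge k 0 with hk | hk
  · rw [P_of_neg _ hk, P_of_neg _ (by omega : k - 1 < 0),
      show P (m + 1) k = fun _ => 0 from funext fun y => P_of_neg _ hk y]
    simpa using hasDerivAt_const x (0 : ℝ)
  lift k to ℕ using hk with j
  have hfun : P (m + 1) (j : ℤ) =
      fun y => ((m + j).choose j : ℝ) * y ^ j * ((1 + y) ^ (m + 1 + j))⁻¹ :=
    funext fun y => P_succ_natCast m j y
  rw [hfun]
  have h1 : HasDerivAt (fun y : ℝ => 1 + y) 1 x := (hasDerivAt_id x).const_add 1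
  have h := (((hasDerivAt_pow j x).const_mul ((m + j).choose j : ℝ))).mul
    ((h1.fun_pow (m + 1 + j)).fun_inv (pow_ne_zero _ hx0))
  refine h.congr_deriv ?_
  have hc := choose_mul_eq_choose_succ_mul m j
  cases j with
  | zero =>
    rw [P_of_neg _ (by simp), P_succ_natCast (m + 1)]
    simp
    field_simp
    ring
  | succ i =>
    have hc' := choose_mul_eq_choose_mul m i
    rw [show (((i + 1 : ℕ) : ℤ) - 1) = (i : ℤ) by push_cast; ring, P_succ_natCast (m + 1),
      P_succ_natCast (m + 1)]
    rw [show m + 1 + (i + 1) - 1 = m + 1 + i by omega]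
    simp only [Nat.add_sub_cancel]
    push_cast at hc hc' ⊢
    rw [show m + 1 + 1 + (i + 1) = m + 1 + i + 2 by omega,
      show m + 1 + (i + 1) = m + 1 + i + 1 by omega,
      show m + 1 + 1 + i = m + 1 + i + 1 by omega] at *
    simp only [pow_succ _ (m + 1 + i), pow_add _ (m + 1 + i) 2, pow_succ x i]
    have hA : (1 + x) ^ (m + 1 + i) ≠ 0 := pow_ne_zero _ hx0
    generalize (1 + x) ^ (m + 1 + i) = A at hA ⊢
    generalize x ^ i = B
    field_simp
    linear_combination B * (1 + x) * hc' - B * x * hc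

theorem continuousOn_P_succ (m : ℕ) (k : ℤ) : ContinuousOn (P (m + 1) k) (Ioi (-1)) :=
  fun _ hx => (hasDerivAt_P_succ m k hx).continuousAt.continuousWithinAt

/-- `k P_{n,k}(x) = n x P_{n+1,k-1}(x)`. -/
theorem mul_P_succ_eq (m : ℕ) (k : ℤ) (x : ℝ) :
    k * P (m + 1) k x = (m + 1) * (x * P (m + 2) (k - 1) x) := by
  rcases lt_trichotomy k 0 with hk | rfl | hk
  · rw [P_of_neg _ hk, P_of_neg _ (by omega)]; simp
  · rw [P_of_neg (m + 2) (by simp)]; simp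
  obtain ⟨i, rfl⟩ : ∃ i : ℕ, k = ((i + 1 : ℕ) : ℤ) := ⟨(k - 1).toNat, by omega⟩
  rw [show (((i + 1 : ℕ) : ℤ) - 1) = (i : ℤ) by push_cast; ring, P_succ_natCast,
    P_succ_natCast (m + 1), show m + 1 + 1 + i = m + 1 + (i + 1) by omega, pow_succ]
  have hc := choose_mul_eq_choose_mul m i
  push_cast at hc ⊢
  linear_combination x ^ i * x * ((1 + x) ^ (m + 1 + (i + 1)))⁻¹ * hc

/-- `(n + k) P_{n,k}(x) = n (1 + x) P_{n+1,k}(x)`. -/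
theorem add_mul_P_succ_eq (m : ℕ) (k : ℤ) {x : ℝ} (hx : -1 < x) :
    (m + 1 + k) * P (m + 1) k x = (m + 1) * ((1 + x) * P (m + 2) k x) := by
  have hx0 : 1 + x ≠ 0 := by linarith
  rcases lt_or_ge k 0 with hk | hk
  · simp [P_of_neg _ hk]
  lift k to ℕ using hk with j
  rw [P_succ_natCast, P_succ_natCast (m + 1), show m + 1 + 1 + j = m + 1 + j + 1 by omega]
  have hc := choose_mul_eq_choose_succ_mul m j
  rw [pow_succ (1 + x), mul_inv]
  have hinv : (1 + x) * (1 + x)⁻¹ = 1 := mul_inv_cancel₀ hx0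
  push_cast
  linear_combination x ^ j * ((1 + x) ^ (m + 1 + j))⁻¹ * hc
    - (m + 1) * ((m + 1 + j).choose j : ℝ) * x ^ j * ((1 + x) ^ (m + 1 + j))⁻¹ * hinv

/-- `k (n + k) P_{n,k} = n (n + 1) ψ P_{n+2,k-1}`. -/
theorem mul_add_mul_P_succ_eq (m : ℕ) (k : ℤ) {x : ℝ} (hx : -1 < x) :
    k * (m + 1 + k) * P (m + 1) k x = (m + 1) * (m + 2) * (psi x * P (m + 3) (k - 1) x) := by
  have h1 := mul_P_succ_eq m k x
  have h2 := add_mul_P_succ_eq (m + 1) (k - 1) hx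
  push_cast at h2
  rw [psi]
  linear_combination (m + 1 + k : ℝ) * h1 + (m + 1) * x * h2

theorem hasDerivAt_deriv_P_succ (m : ℕ) (k : ℤ) {x : ℝ} (hx : -1 < x) :
    HasDerivAt (fun y => (m + 1 : ℝ) * (P (m + 2) (k - 1) y - P (m + 2) k y))
      ((m + 1) * (m + 2) * (P (m + 3) (k - 2) x - 2 * P (m + 3) (k - 1) x + P (m + 3) k x)) x := by
  have h := ((hasDerivAt_P_succ (m + 1) (k - 1) hx).sub
    (hasDerivAt_P_succ (m + 1) k hx)).const_mul (m + 1 : ℝ)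
  refine h.congr_deriv ?_
  rw [show k - 1 - 1 = k - 2 by ring]
  push_cast
  ring

theorem Dt_P_succ (m : ℕ) (k : ℤ) {x : ℝ} (hx : -1 < x) :
    Dt (P (m + 1) k) x = (k - 1) * (m + k) * P (m + 1) (k - 1) x
      - 2 * (k * (m + 1 + k) * P (m + 1) k x)
      + (k + 1) * (m + 2 + k) * P (m + 1) (k + 1) x := by
  have hev : deriv (P (m + 1) k) =ᶠ[𝓝 x]
      fun y => (m + 1 : ℝ) * (P (m + 2) (k - 1) y - P (m + 2) k y) := by
    filter_upwards [Ioi_mem_nhds hx] with y hy using (hasDerivAt_P_succ m k hy).deriv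
  rw [Dt, hev.deriv_eq, (hasDerivAt_deriv_P_succ m k hx).deriv]
  have h1 := mul_add_mul_P_succ_eq m (k - 1) hx
  have h2 := mul_add_mul_P_succ_eq m k hx
  have h3 := mul_add_mul_P_succ_eq m (k + 1) hx
  rw [show k - 1 - 1 = k - 2 by ring] at h1
  rw [show k + 1 - 1 = k by ring] at h3
  push_cast at h1 h3
  linear_combination -h1 + 2 * h2 - h3

theorem summable_P_succ (m : ℕ) {x : ℝ} (hx : 0 ≤ x) :
    Summable fun k : ℕ => P (m + 1) (k : ℤ) x := by
  have hx0 : 0 < 1 + x := by linarith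
  have hr : ‖x / (1 + x)‖ < 1 := by
    rw [Real.norm_of_nonneg (by positivity), div_lt_one hx0]
    linarith
  refine ((summable_choose_mul_geometric_of_norm_lt_one m hr).mul_left
    ((1 + x) ^ (m + 1))⁻¹).congr fun k => ?_
  rw [P_succ_natCast, ← Nat.choose_symm_add, add_comm k m, pow_add (1 + x) (m + 1) k, div_pow, mul_inv,
    div_eq_mul_inv]
  generalize (1 + x) ^ (m + 1) = A
  generalize (1 + x) ^ k = B
  ring

theorem P_succ_le (m j : ℕ) {x : ℝ} (hx : 0 ≤ x) :
    P (m + 1) (j : ℤ) x ≤ ((m + j).choose j : ℝ) * ((1 + x) ^ (m + 1))⁻¹ := by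
  rw [P_succ_natCast, pow_add _ (m + 1) j, mul_inv, mul_assoc]
  refine mul_le_mul_of_nonneg_left ?_ (by positivity)
  rw [mul_left_comm]
  refine mul_le_of_le_one_right (by positivity) ?_
  rw [← div_eq_mul_inv]
  exact div_le_one_of_le₀ (pow_le_pow_left₀ hx (by linarith) j) (by positivity)

theorem tendsto_inv_one_add_atTop : Tendsto (fun x : ℝ => (1 + x)⁻¹) atTop (𝓝 0) :=
  tendsto_inv_atTop_zero.comp (tendsto_atTop_add_const_left _ _ tendsto_id)

theorem tendsto_P_succ_atTop (m : ℕ) (k : ℤ) : Tendsto (P (m + 1) k) atTop (𝓝 0) := by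
  rcases lt_or_ge k 0 with hk | hk
  · exact tendsto_const_nhds.congr fun x => (P_of_neg _ hk x).symm
  lift k to ℕ using hk with j
  have h := (tendsto_inv_one_add_atTop.pow (m + 1)).const_mul ((m + j).choose j : ℝ)
  simp only [zero_pow (Nat.succ_ne_zero m), mul_zero, inv_pow] at h
  refine tendsto_of_tendsto_of_tendsto_of_le_of_le' tendsto_const_nhds h ?_ ?_
  · filter_upwards [eventually_ge_atTop 0] with x hx using P_nonneg _ _ hx
  · filter_upwards [eventually_ge_atTop 0] with x hx using P_succ_le m j hx

theorem integrableOn_inv_one_add_sq : IntegrableOn (fun x : ℝ => ((1 + x) ^ 2)⁻¹) (Ioi 0) := by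
  have h : Tendsto (fun x : ℝ => -(1 + x)⁻¹) atTop (𝓝 0) := by
    simpa using tendsto_inv_one_add_atTop.neg
  refine integrableOn_Ioi_deriv_of_nonneg' (fun x hx => ?_) (fun x _ => by positivity) h
  have hx0 : 1 + x ≠ 0 := by have : 0 ≤ x := hx; positivity
  refine ((((hasDerivAt_id x).const_add 1).fun_inv hx0).neg).congr_deriv ?_
  simp [neg_div]

theorem integrableOn_P (m : ℕ) (k : ℤ) : IntegrableOn (P (m + 2) k) (Ioi 0) := by
  rcases lt_or_ge k 0 with hk | hk
  · rw [show P (m + 2) k = fun _ => 0 from funext fun y => P_of_neg _ hk y]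
    exact integrableOn_zero
  lift k to ℕ using hk with j
  refine Integrable.mono' (integrableOn_inv_one_add_sq.const_mul ((m + 1 + j).choose j : ℝ))
    (((continuousOn_P_succ (m + 1) j).mono
      (Ioi_subset_Ioi (by norm_num))).aestronglyMeasurable measurableSet_Ioi) ?_
  filter_upwards [ae_restrict_mem measurableSet_Ioi] with x hx
  have hx : 0 < x := hx
  rw [Real.norm_of_nonneg (P_nonneg _ _ hx.le)]
  refine (P_succ_le (m + 1) j hx.le).trans (mul_le_mul_of_nonneg_left ?_ (by positivity))
  exact inv_anti₀ (by positivity) (pow_le_pow_right₀ (by linarith) (by omega))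

theorem integrableOn_P_mul (m : ℕ) (k : ℤ) {g : ℝ → ℝ} (hg : ContinuousOn g (Ioi 0)) {M : ℝ}
    (hM : ∀ x ∈ Ioi (0 : ℝ), |g x| ≤ M) :
    IntegrableOn (fun x => P (m + 2) k x * g x) (Ioi 0) :=
  (integrableOn_P m k).mul_bdd (c := M) (hg.aestronglyMeasurable measurableSet_Ioi)
    ((ae_restrict_mem measurableSet_Ioi).mono hM)

theorem integral_P (m j : ℕ) : (m + 1 : ℝ) * ∫ x in Ioi 0, P (m + 2) (j : ℤ) x = 1 := by
  have key (k : ℤ) : (m + 1 : ℝ) * ((∫ x in Ioi 0, P (m + 2) (k - 1) x) -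
      ∫ x in Ioi 0, P (m + 2) k x) = 0 - P (m + 1) k 0 := by
    rw [← integral_sub (integrableOn_P m _) (integrableOn_P m _), ← integral_const_mul]
    exact integral_Ioi_of_hasDerivAt_of_tendsto'
      (fun x hx => hasDerivAt_P_succ m k (by have : 0 ≤ x := hx; linarith))
      (((integrableOn_P m _).sub (integrableOn_P m _)).const_mul _) (tendsto_P_succ_atTop m k)
  induction j with
  | zero =>
    have h := key 0
    rw [P_succ_zero_zero, show P (m + 2) (0 - 1) = fun _ => 0 from
      funext fun y => P_of_neg _ (by norm_num) y, integral_zero] at h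
    push_cast
    linarith
  | succ j ih =>
    have h := key ((j + 1 : ℕ) : ℤ)
    rw [P_apply_zero _ (by omega),
      show (((j + 1 : ℕ) : ℤ) - 1) = (j : ℤ) by push_cast; ring] at h
    linarith

end Basis

section IntegrationByParts

variable {f : ℝ → ℝ} {M : ℝ}

theorem abs_mul_deriv_sub_le (hf : DifferentiableOn ℝ f (Ioi 0))
    (hf' : DifferentiableOn ℝ (deriv f) (Ioi 0)) (hM : ∀ x ∈ Ioi (0 : ℝ), |Dt f x| ≤ M)
    {x : ℝ} (hx : 0 < x) : |x * deriv f x - (f (2 * x) - f x)| ≤ M * (x / (1 + x)) := by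
  have hpsi : 0 < psi x := by unfold psi; positivity
  have hM0 : 0 ≤ M := (abs_nonneg _).trans (hM x hx)
  obtain ⟨ξ, hξ, hslope⟩ := exists_deriv_eq_slope f (show x < 2 * x by linarith)
    (hf.continuousOn.mono fun y hy => hx.trans_le hy.1)
    (hf.mono fun y hy => hx.trans hy.1)
  have hbound : ∀ y ∈ Ici x, ‖deriv (deriv f) y‖ ≤ M / psi x := by
    intro y hy
    have hy : x ≤ y := hy
    have hpsiy : psi x ≤ psi y := by have : 0 ≤ y := hx.le.trans hy; unfold psi; gcongr
    have h := hM y (hx.trans_le hy)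
    rw [Dt, abs_mul, abs_of_pos (hpsi.trans_le hpsiy)] at h
    rw [Real.norm_eq_abs, le_div_iff₀ hpsi, mul_comm]
    exact (mul_le_mul_of_nonneg_right hpsiy (abs_nonneg _)).trans h
  have hlip := (convex_Ici x).norm_image_sub_le_of_norm_deriv_le
    (fun y hy => hf'.differentiableAt (Ioi_mem_nhds (hx.trans_le hy))) hbound
    (self_mem_Ici : x ∈ Ici x) (show ξ ∈ Ici x from hξ.1.le)
  have hξx : ‖ξ - x‖ ≤ x := by
    rw [Real.norm_of_nonneg (by linarith [hξ.1])]
    linarith [hξ.2]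
  have hval : f (2 * x) - f x = x * deriv f ξ := by
    rw [hslope]
    field_simp
    ring
  rw [hval, ← mul_sub, abs_mul, abs_of_pos hx, abs_sub_comm]
  calc x * |deriv f ξ - deriv f x| ≤ x * (M / psi x * x) := by
        refine mul_le_mul_of_nonneg_left (hlip.trans ?_) hx.le
        exact mul_le_mul_of_nonneg_left hξx (by positivity)
    _ = M * (x / (1 + x)) := by
        unfold psi
        field_simp

theorem abs_mul_deriv_le (hf : DifferentiableOn ℝ f (Ioi 0))
    (hf' : DifferentiableOn ℝ (deriv f) (Ioi 0)) (hM : ∀ x ∈ Ioi (0 : ℝ), |Dt f x| ≤ M)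
    {B : ℝ} (hB : ∀ x ∈ Ici (0 : ℝ), |f x| ≤ B) {x : ℝ} (hx : 0 < x) :
    |x * deriv f x| ≤ M + 2 * B := by
  have h := abs_mul_deriv_sub_le hf hf' hM hx
  have hM0 : 0 ≤ M := (abs_nonneg _).trans (hM x hx)
  have hle : M * (x / (1 + x)) ≤ M :=
    mul_le_of_le_one_right hM0 (div_le_one_of_le₀ (by linarith) (by linarith))
  have h1 := abs_le.1 (hB x hx.le)
  have h2 := abs_le.1 (hB (2 * x) (by rw [mem_Ici]; linarith))
  have h3 := abs_le.1 h
  rw [abs_le]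
  constructor <;> linarith

theorem tendsto_mul_deriv_nhdsGT_zero (hf : DifferentiableOn ℝ f (Ioi 0))
    (hf' : DifferentiableOn ℝ (deriv f) (Ioi 0)) (hM : ∀ x ∈ Ioi (0 : ℝ), |Dt f x| ≤ M)
    (hcont : ContinuousOn f (Ici 0)) :
    Tendsto (fun x => x * deriv f x) (𝓝[>] 0) (𝓝 0) := by
  have hid : Tendsto (fun x : ℝ => x) (𝓝[>] 0) (𝓝 0) := tendsto_id.mono_left nhdsWithin_le_nhds
  have hpos : ∀ᶠ x : ℝ in 𝓝[>] 0, 0 < x := self_mem_nhdsWithin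
  have h0 : Tendsto f (𝓝[≥] 0) (𝓝 (f 0)) := hcont 0 self_mem_Ici
  have h1 : Tendsto f (𝓝[>] 0) (𝓝 (f 0)) :=
    h0.mono_left (nhdsWithin_mono _ Ioi_subset_Ici_self)
  have h2 : Tendsto (fun x => f (2 * x)) (𝓝[>] 0) (𝓝 (f 0)) := by
    refine h1.comp (tendsto_nhdsWithin_iff.2 ⟨by simpa using hid.const_mul 2, ?_⟩)
    filter_upwards [hpos] with x hx
    rw [mem_Ioi]
    linarith
  have h3 : Tendsto (fun x : ℝ => M * (x / (1 + x))) (𝓝[>] 0) (𝓝 0) := by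
    simpa using (hid.div (hid.const_add 1) (by simp)).const_mul M
  have h4 : Tendsto (fun x => x * deriv f x - (f (2 * x) - f x)) (𝓝[>] 0) (𝓝 0) := by
    refine squeeze_zero_norm' ?_ h3
    filter_upwards [hpos] with x hx using abs_mul_deriv_sub_le hf hf' hM hx
  simpa using h4.add (h2.sub h1)

/-- Integration by parts twice against a Baskakov basis function. -/
theorem integral_P_mul_Dt (m j : ℕ) (hf : DifferentiableOn ℝ f (Ioi 0))
    (hf' : DifferentiableOn ℝ (deriv f) (Ioi 0)) (hM : ∀ x ∈ Ioi (0 : ℝ), |Dt f x| ≤ M)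
    (hcont : ContinuousOn f (Ici 0)) {B : ℝ} (hB : ∀ x ∈ Ici (0 : ℝ), |f x| ≤ B)
    (hDf : ContinuousOn (Dt f) (Ioi 0)) :
    (m + 2 : ℝ) * ∫ x in Ioi 0, P (m + 3) j x * Dt f x =
      (j + 1) * (m + 2 + j) * ((m + 2) * ((∫ x in Ioi 0, P (m + 3) (j - 1) x * f x)
        - 2 * (∫ x in Ioi 0, P (m + 3) j x * f x) + ∫ x in Ioi 0, P (m + 3) (j + 1) x * f x)
        + P (m + 2) j 0 * f 0) := by
  set a : ℝ := (j + 1) * (m + 2 + j) with ha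
  have hB' : ∀ x ∈ Ioi (0 : ℝ), |f x| ≤ B := fun x hx => hB x (Ioi_subset_Ici_self hx)
  have hint (k : ℤ) : IntegrableOn (fun x => P (m + 3) k x * f x) (Ioi 0) :=
    integrableOn_P_mul (m + 1) k hf.continuousOn hB'
  have hintD : IntegrableOn (fun x => P (m + 3) j x * Dt f x) (Ioi 0) :=
    integrableOn_P_mul (m + 1) j hDf hM
  let q : ℝ → ℝ := fun x =>
    P (m + 3) (j - 1) x * f x - 2 * (P (m + 3) j x * f x) + P (m + 3) (j + 1) x * f x
  have hq : IntegrableOn q (Ioi 0) := ((hint _).sub ((hint _).const_mul 2)).add (hint _)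
  have hq_eq : ∫ x in Ioi 0, q x = (∫ x in Ioi 0, P (m + 3) (j - 1) x * f x)
      - 2 * (∫ x in Ioi 0, P (m + 3) j x * f x) + ∫ x in Ioi 0, P (m + 3) (j + 1) x * f x := by
    rw [← integral_const_mul, ← integral_sub (hint _) ((hint _).const_mul 2)]
    exact integral_add ((hint _).sub ((hint _).const_mul 2)) (hint _)
  let P' : ℝ → ℝ := fun x => (m + 1 : ℝ) * (P (m + 2) j x - P (m + 2) (j + 1) x)
  let u : ℝ → ℝ := fun x => a * (P (m + 1) (j + 1) x * deriv f x - P' x * f x)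
  let u' : ℝ → ℝ := fun x => (m + 1) * (m + 2) * (P (m + 3) j x * Dt f x - a * q x)
  have hu (x : ℝ) (hx : x ∈ Ioi (0 : ℝ)) : HasDerivAt u (u' x) x := by
    have hx1 : -1 < x := by linarith [mem_Ioi.1 hx]
    have h1 := hasDerivAt_P_succ m (j + 1) hx1
    have h2 := hasDerivAt_deriv_P_succ m (j + 1) hx1
    rw [add_sub_cancel_right] at h1 h2
    have h3 := (hf.differentiableAt (Ioi_mem_nhds hx)).hasDerivAt
    have h4 := (hf'.differentiableAt (Ioi_mem_nhds hx)).hasDerivAt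
    refine (((h1.mul h4).sub (h2.mul h3)).const_mul a).congr_deriv ?_
    have h5 := mul_add_mul_P_succ_eq m (j + 1) hx1
    rw [add_sub_cancel_right] at h5
    rw [show (j : ℤ) + 1 - 2 = j - 1 by ring]
    simp only [u', q, Dt, ha]
    push_cast at h5
    linear_combination deriv (deriv f) x * h5
  have hu'int : IntegrableOn u' (Ioi 0) :=
    (hintD.sub (hq.const_mul a)).const_mul _
  have hu_eq (x : ℝ) : u x = (m + 1) * (m + 2 + j) * (P (m + 2) j x * (x * deriv f x))
      - a * (P' x * f x) := by
    have h5 := mul_P_succ_eq m (j + 1) x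
    rw [add_sub_cancel_right] at h5
    push_cast at h5
    simp only [u, ha]
    linear_combination (m + 2 + j) * deriv f x * h5
  have hP0 (k : ℤ) : Tendsto (P (m + 2) k) (𝓝[>] 0) (𝓝 (P (m + 2) k 0)) :=
    (hasDerivAt_P_succ (m + 1) k (by norm_num)).continuousAt.tendsto.mono_left nhdsWithin_le_nhds
  have hf0 : Tendsto f (𝓝[>] 0) (𝓝 (f 0)) :=
    (show Tendsto f (𝓝[≥] 0) (𝓝 (f 0)) from hcont 0 self_mem_Ici).mono_left
      (nhdsWithin_mono _ Ioi_subset_Ici_self)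
  have hzero : Tendsto u (𝓝[>] 0) (𝓝 (-(a * ((m + 1) * P (m + 2) j 0 * f 0)))) := by
    have h := ((((hP0 j).mul (tendsto_mul_deriv_nhdsGT_zero hf hf' hM hcont)).const_mul
      ((m + 1) * (m + 2 + j) : ℝ))).sub
      (((((hP0 j).sub (hP0 (j + 1))).const_mul (m + 1 : ℝ)).mul hf0).const_mul a)
    rw [P_apply_zero (m + 2) (by omega : (j : ℤ) + 1 ≠ 0), mul_zero, mul_zero, zero_sub,
      sub_zero] at h
    exact h.congr fun x => (hu_eq x).symm
  have hinfty : Tendsto u atTop (𝓝 0) := by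
    have hPtop (k : ℤ) := tendsto_P_succ_atTop (m + 1) k
    have h1 : Tendsto (fun x => P (m + 2) j x * (x * deriv f x)) atTop (𝓝 0) := by
      refine (hPtop j).zero_mul_isBoundedUnder_le ⟨M + 2 * B, ?_⟩
      rw [eventually_map]
      filter_upwards [eventually_gt_atTop 0] with x hx using abs_mul_deriv_le hf hf' hM hB hx
    have h2 : Tendsto (fun x => P' x * f x) atTop (𝓝 0) := by
      have h3 : Tendsto P' atTop (𝓝 0) := by
        simpa using ((hPtop j).sub (hPtop (j + 1))).const_mul (m + 1 : ℝ)
      refine h3.zero_mul_isBoundedUnder_le ⟨B, ?_⟩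
      rw [eventually_map]
      filter_upwards [eventually_ge_atTop 0] with x hx using hB x hx
    have h := (h1.const_mul ((m + 1) * (m + 2 + j) : ℝ)).sub (h2.const_mul a)
    rw [mul_zero, mul_zero, sub_zero] at h
    exact h.congr fun x => (hu_eq x).symm
  have key : ∫ x in Ioi 0, u' x = 0 - -(a * ((m + 1) * P (m + 2) j 0 * f 0)) := by
    have h := integral_Ioi_deriv_mul_eq_sub (v := fun _ => (1 : ℝ)) (v' := fun _ => 0) hu
      (fun x _ => hasDerivAt_const x 1) (a' := -(a * ((m + 1) * P (m + 2) j 0 * f 0))) (b' := 0)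
      (hu'int.congr_fun (fun x _ => by simp) measurableSet_Ioi)
      (hzero.congr fun x => by simp) (hinfty.congr fun x => by simp)
    simpa using h
  rw [integral_const_mul, integral_sub hintD (hq.const_mul a), integral_const_mul, hq_eq] at key
  have hm : (m + 1 : ℝ) ≠ 0 := by positivity
  refine mul_left_cancel₀ hm ?_
  linear_combination key

end IntegrationByParts

section Functionals

theorem v_zero (n : ℕ) (g : ℝ → ℝ) : v n 0 g = g 0 := by simp [v]

theorem v_succ (m j : ℕ) (g : ℝ → ℝ) :
    v (m + 1) (j + 1) g = (m + 2) * ∫ t in Ioi 0, P (m + 3) j t * g t := by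
  rw [v, if_neg (Nat.succ_ne_zero j)]
  push_cast
  rw [add_sub_cancel_right]
  ring

theorem abs_v_le (m k : ℕ) {g : ℝ → ℝ} {M : ℝ} (hg : ContinuousOn g (Ioi 0))
    (hM : ∀ x ∈ Ici (0 : ℝ), |g x| ≤ M) : |v (m + 1) k g| ≤ M := by
  have hM' : ∀ x ∈ Ioi (0 : ℝ), |g x| ≤ M := fun x hx => hM x (Ioi_subset_Ici_self hx)
  cases k with
  | zero =>
    rw [v_zero]
    exact hM 0 self_mem_Ici
  | succ j =>
    have h1 : |∫ t in Ioi 0, P (m + 3) j t * g t| ≤ ∫ t in Ioi 0, P (m + 3) j t * M := by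
      refine (norm_integral_le_integral_norm _).trans (setIntegral_mono_on
        (integrableOn_P_mul (m + 1) j hg hM').norm ((integrableOn_P (m + 1) j).mul_const M)
        measurableSet_Ioi fun t ht => ?_)
      have hP := P_nonneg (m + 3) j (le_of_lt (mem_Ioi.1 ht))
      rw [norm_mul, Real.norm_of_nonneg hP]
      exact mul_le_mul_of_nonneg_left (hM' t ht) hP
    rw [integral_mul_const] at h1
    have h2 := integral_P (m + 1) j
    push_cast at h2
    rw [v_succ, abs_mul, abs_of_pos (by positivity : (0 : ℝ) < m + 2)]
    calc (m + 2 : ℝ) * |∫ t in Ioi 0, P (m + 3) j t * g t|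
        ≤ (m + 2) * ((∫ t in Ioi 0, P (m + 3) j t) * M) := by gcongr
      _ = M := by linear_combination M * h2

theorem summable_v_mul_P (m : ℕ) {g : ℝ → ℝ} {M : ℝ} (hg : ContinuousOn g (Ioi 0))
    (hM : ∀ x ∈ Ici (0 : ℝ), |g x| ≤ M) {x : ℝ} (hx : 0 ≤ x) :
    Summable fun k : ℕ => v (m + 1) k g * P (m + 1) k x :=
  ((summable_P_succ m hx).mul_left M).of_norm_bounded fun k => by
    rw [norm_mul, Real.norm_of_nonneg (P_nonneg _ _ hx)]
    exact mul_le_mul_of_nonneg_right (abs_v_le m k hg hM) (P_nonneg _ _ hx)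

theorem v_sub_const_mul (m k : ℕ) {f g : ℝ → ℝ} (c : ℝ) {B M : ℝ} (hf : ContinuousOn f (Ioi 0))
    (hB : ∀ x ∈ Ioi (0 : ℝ), |f x| ≤ B) (hg : ContinuousOn g (Ioi 0))
    (hM : ∀ x ∈ Ioi (0 : ℝ), |g x| ≤ M) :
    v (m + 1) k (fun y => f y - c * g y) = v (m + 1) k f - c * v (m + 1) k g := by
  cases k with
  | zero => simp only [v_zero]
  | succ j =>
    have h1 := integrableOn_P_mul (m + 1) j hf hB
    have h2 := integrableOn_P_mul (m + 1) j hg hM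
    have h : ∫ t in Ioi 0, P (m + 3) j t * (f t - c * g t) =
        (∫ t in Ioi 0, P (m + 3) j t * f t) - c * ∫ t in Ioi 0, P (m + 3) j t * g t := by
      rw [← integral_const_mul, ← integral_sub h1 (h2.const_mul c)]
      congr 1 with t
      ring
    rw [v_succ, v_succ, v_succ, h]
    ring

/-- The functionals `v_{n,k}` turn `D̃` into a weighted second difference. At `k = 0` both sides
vanish. -/
theorem v_Dt (m k : ℕ) {f : ℝ → ℝ} {M B : ℝ} (hf : DifferentiableOn ℝ f (Ioi 0))
    (hf' : DifferentiableOn ℝ (deriv f) (Ioi 0)) (hM : ∀ x ∈ Ioi (0 : ℝ), |Dt f x| ≤ M)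
    (hcont : ContinuousOn f (Ici 0)) (hB : ∀ x ∈ Ici (0 : ℝ), |f x| ≤ B)
    (hDf : ContinuousOn (Dt f) (Ioi 0)) :
    v (m + 1) k (Dt f) = k * (m + 1 + k) *
      (v (m + 1) (k - 1) f - 2 * v (m + 1) k f + v (m + 1) (k + 1) f) := by
  cases k with
  | zero => simp [v_zero, Dt, psi]
  | succ j =>
    have h := integral_P_mul_Dt m j hf hf' hM hcont hB hDf
    rw [v_succ, v_succ, v_succ, h, Nat.add_sub_cancel]
    cases j with
    | zero =>
      have h0 : ∀ t, P (m + 3) (((0 : ℕ) : ℤ) - 1) t = 0 := fun t => P_of_neg _ (by simp) t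
      have h1 : P (m + 2) ((0 : ℕ) : ℤ) 0 = 1 := P_succ_zero_zero (m + 1)
      simp only [h0, h1, v_zero, zero_mul, integral_zero]
      push_cast
      ring
    | succ i =>
      rw [v_succ, P_apply_zero _ (by omega : ((i + 1 : ℕ) : ℤ) ≠ 0)]
      push_cast
      rw [add_sub_cancel_right]
      ring

end Functionals

section Summation

/-- Summation by parts for a second difference. -/
theorem hasSum_mul_second_difference {w b : ℕ → ℝ} {B : ℝ} (hw : ∀ k, |w k| ≤ B)
    (hb : Summable b) (hb0 : b 0 = 0) :
    HasSum (fun k => w k * ((if k = 0 then 0 else b (k - 1)) - 2 * b k + b (k + 1)))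
      (∑' k, b k * (w (k - 1) - 2 * w k + w (k + 1))) := by
  have hmul {c : ℕ → ℝ} (hc : ∀ k, |c k| ≤ B) : Summable fun k => c k * b k :=
    hb.abs.mul_left B |>.of_norm_bounded fun k => by
      rw [norm_mul]
      exact mul_le_mul_of_nonneg_right (hc k) (abs_nonneg _)
  have s1 : Summable fun k => w (k - 1) * b k := hmul fun k => hw _
  have s2 : Summable fun k => w k * b k := hmul hw
  have s3 : Summable fun k => w (k + 1) * b k := hmul fun k => hw _
  have h1 : HasSum (fun k => w k * b (k + 1)) (∑' k, w (k - 1) * b k) := by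
    have h := (hasSum_nat_add_iff' 1).2 s1.hasSum
    simpa [hb0] using h
  have h3 : HasSum (fun k => w k * (if k = 0 then 0 else b (k - 1))) (∑' k, w (k + 1) * b k) := by
    refine (hasSum_nat_add_iff' 1).1 ?_
    simpa using s3.hasSum
  have htot := (h3.sub (s2.hasSum.mul_left 2)).add h1
  have hval : ∑' k, b k * (w (k - 1) - 2 * w k + w (k + 1)) =
      ∑' k, w (k + 1) * b k - 2 * ∑' k, w k * b k + ∑' k, w (k - 1) * b k := by
    rw [← ((s3.hasSum.sub (s2.hasSum.mul_left 2)).add s1.hasSum).tsum_eq]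
    exact tsum_congr fun k => by ring
  rw [hval]
  exact htot.congr_fun fun k => by ring

end Summation

theorem Vt_eq_V_sub (n : ℕ) (hn : 1 ≤ n) (f : ℝ → ℝ) (hf : BddContOn f) (hfW : MemW20 f)
    (hDf_cont : ContinuousOn (Dt f) (Set.Ioi 0))
    (hDf_bdd : ∃ M, ∀ x ∈ Set.Ioi (0 : ℝ), |Dt f x| ≤ M) :
    ∀ x ∈ Set.Ici (0 : ℝ), Vt n f x = V n (fun y => f y - (1 / (n : ℝ)) * Dt f y) x := by
  intro x hx
  have hx : 0 ≤ x := hx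
  have hx1 : -1 < x := by linarith
  obtain ⟨m, rfl⟩ : ∃ m, n = m + 1 := ⟨n - 1, by omega⟩
  obtain ⟨hcont, B, hB⟩ := hf
  obtain ⟨⟨hd, hd', -⟩, -⟩ := hfW
  obtain ⟨M, hM⟩ := hDf_bdd
  have hB' : ∀ x ∈ Ioi (0 : ℝ), |f x| ≤ B := fun x hx => hB x (Ioi_subset_Ici_self hx)
  have hw (k : ℕ) : |v (m + 1) k f| ≤ B := abs_v_le m k hd.continuousOn hB
  let b : ℕ → ℝ := fun k => k * (m + 1 + k) * P (m + 1) k x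
  have hb0 : b 0 = 0 := by simp [b]
  have hb : Summable b := by
    refine (summable_nat_add_iff 1).1 (((summable_P_succ (m + 2) hx).mul_left
      ((m + 1) * (m + 2) * psi x : ℝ)).congr fun j => ?_)
    have h := mul_add_mul_P_succ_eq m ((j + 1 : ℕ) : ℤ) hx1
    rw [show ((j + 1 : ℕ) : ℤ) - 1 = j by push_cast; ring] at h
    simp only [b]
    push_cast at h ⊢
    linear_combination -h
  have hDP (k : ℕ) : Dt (P (m + 1) k) x =
      (if k = 0 then 0 else b (k - 1)) - 2 * b k + b (k + 1) := by
    rw [Dt_P_succ m k hx1]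
    cases k with
    | zero =>
      rw [P_of_neg _ (by simp : ((0 : ℕ) : ℤ) - 1 < 0)]
      simp only [b, if_true]
      push_cast
      ring
    | succ j =>
      simp only [b, if_neg (Nat.succ_ne_zero j), Nat.add_sub_cancel]
      push_cast
      rw [add_sub_cancel_right (j : ℤ)]
      ring
  have hM' : ∀ y ∈ Ici (0 : ℝ), |Dt f y| ≤ M := by
    intro y hy
    rcases eq_or_lt_of_le (mem_Ici.1 hy) with rfl | hy0
    · simpa [Dt, psi] using (abs_nonneg _).trans (hM 1 (mem_Ioi.2 one_pos))
    · exact hM y hy0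
  have hsum := summable_v_mul_P m hd.continuousOn hB hx
  have hsumD := summable_v_mul_P m hDf_cont hM' hx
  have hdiff := hasSum_mul_second_difference hw hb hb0
  have hvD (k : ℕ) : v (m + 1) k (Dt f) * P (m + 1) k x =
      b k * (v (m + 1) (k - 1) f - 2 * v (m + 1) k f + v (m + 1) (k + 1) f) := by
    rw [v_Dt m k hd hd' hM hcont hB hDf_cont]
    simp only [b]
    ring
  simp only [hvD] at hsumD
  have hVt := hsum.hasSum.sub (hdiff.mul_left (1 / ((m + 1 : ℕ) : ℝ)))
  have hV := hsum.hasSum.sub (hsumD.hasSum.mul_left (1 / ((m + 1 : ℕ) : ℝ)))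
  rw [Vt, V]
  refine Eq.trans ?_ (hVt.tsum_eq.trans (hV.tsum_eq.symm.trans ?_))
  · exact tsum_congr fun k => by rw [hDP]; ring
  · refine tsum_congr fun k => ?_
    rw [v_sub_const_mul m k _ hd.continuousOn hB' hDf_cont hM, ← hvD]
    ring
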